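/- arXiv:math/9810158 — 2 statements merged into one kernel-verified Lean document; each statement's English description precedes it below -/
import Mathlib

section
/- The Moyal product is associative: for all f, g, h in ℝ[x,p], (f *_λ g) *_λ h = f *_λ (g *_λ h). Consequently ℝ[x,p] equipped with *_λ is an associative ℝ-algebra with unit 1. -/
/- The Moyal product on ℝ[x,p], where x = X 0 and p = X 1 in `MvPolynomial (Fin 2) ℝ`:
   f *_λ g := Σ_{i=0}^∞ (λ^i/i!) Σ_{k=0}^i C(i,k) (−1)^k (∂_x^{i−k}∂_p^k f)·(∂_x^k ∂_p^{i−k} g).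
   On polynomials only finitely many terms are nonzero, so the `finsum` below is faithful. -/

open MvPolynomial

/-- Differentiation with respect to x (the variable `X 0`). -/
noncomputable def dX : MvPolynomial (Fin 2) ℝ → MvPolynomial (Fin 2) ℝ :=
  fun f => pderiv (0 : Fin 2) f

/-- Differentiation with respect to p (the variable `X 1`). -/
noncomputable def dP : MvPolynomial (Fin 2) ℝ → MvPolynomial (Fin 2) ℝ :=
  fun f => pderiv (1 : Fin 2) f

/-- The Moyal star product with deformation parameter `l`. -/
noncomputable def moyal (l : ℝ) (f g : MvPolynomial (Fin 2) ℝ) : MvPolynomial (Fin 2) ℝ :=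
  ∑ᶠ i : ℕ, (l ^ i / (i.factorial : ℝ)) •
    ∑ k ∈ Finset.range (i + 1),
      ((i.choose k : ℝ) * (-1 : ℝ) ^ k) • (dX^[i - k] (dP^[k] f) * dX^[k] (dP^[i - k] g))

lemma pderiv_comm {σ R : Type*} [CommRing R] (f : MvPolynomial σ R) (a b : σ) :
    pderiv a (pderiv b f) = pderiv b (pderiv a f) := by
  classical
  let D : σ → Derivation R (MvPolynomial σ R) (MvPolynomial σ R) := pderiv
  have key : ⁅D a, D b⁆ = 0 := by
    refine MvPolynomial.derivation_ext fun j => ?_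
    simp [D, Derivation.commutator_apply, pderiv_X, Pi.single_apply, apply_ite]
  have := DFunLike.congr_fun key f
  rwa [Derivation.commutator_apply, Derivation.zero_apply, sub_eq_zero] at this

/-- The `i`-th power of the Poisson bidifferential operator `∂ₓ ⊗ ∂ₚ - ∂ₚ ⊗ ∂ₓ`, followed by
multiplication. -/
noncomputable def poissonPow :
    ℕ → MvPolynomial (Fin 2) ℝ →ₗ[ℝ] MvPolynomial (Fin 2) ℝ →ₗ[ℝ] MvPolynomial (Fin 2) ℝ
  | 0 => LinearMap.mul ℝ _
  | i + 1 =>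
    (poissonPow i).compl₁₂ (pderiv 0).toLinearMap (pderiv 1).toLinearMap -
      (poissonPow i).compl₁₂ (pderiv 1).toLinearMap (pderiv 0).toLinearMap

section

variable (l : ℝ) (i : ℕ) (f g h : MvPolynomial (Fin 2) ℝ)

lemma poissonPow_zero : poissonPow 0 f g = f * g := rfl

lemma poissonPow_succ : poissonPow (i + 1) f g =
    poissonPow i (pderiv 0 f) (pderiv 1 g) - poissonPow i (pderiv 1 f) (pderiv 0 g) := rfl

lemma pderiv_poissonPow (a : Fin 2) : pderiv a (poissonPow i f g) =
    poissonPow i (pderiv a f) g + poissonPow i f (pderiv a g) := by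
  induction i generalizing f g with
  | zero => simp only [poissonPow_zero, Derivation.leibniz, smul_eq_mul]; ring
  | succ i ih =>
    simp only [poissonPow_succ, map_sub, ih, pderiv_comm _ a]
    ring

lemma poissonPow_X_zero_mul : poissonPow (i + 1) f (X 0 * g) =
    X 0 * poissonPow (i + 1) f g - (i + 1 : ℝ) • poissonPow i (pderiv 1 f) g := by
  induction i generalizing f g with
  | zero =>
    simp [poissonPow_succ, poissonPow_zero]
    ring
  | succ i ih =>
    rw [poissonPow_succ, Derivation.leibniz, Derivation.leibniz, pderiv_X_self,
      pderiv_X_of_ne (by decide : (0 : Fin 2) ≠ 1)]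
    simp only [smul_eq_mul, mul_zero, mul_one, add_zero, map_add, ih]
    rw [poissonPow_succ (i + 1), poissonPow_succ i (pderiv 1 f) g, pderiv_comm f 1 0]
    push_cast
    simp only [mul_sub]
    module

lemma poissonPow_X_one_mul : poissonPow (i + 1) f (X 1 * g) =
    X 1 * poissonPow (i + 1) f g + (i + 1 : ℝ) • poissonPow i (pderiv 0 f) g := by
  induction i generalizing f g with
  | zero =>
    simp [poissonPow_succ, poissonPow_zero]
    ring
  | succ i ih =>
    rw [poissonPow_succ, Derivation.leibniz, Derivation.leibniz, pderiv_X_self,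
      pderiv_X_of_ne (by decide : (1 : Fin 2) ≠ 0)]
    simp only [smul_eq_mul, mul_zero, mul_one, add_zero, map_add, ih]
    rw [poissonPow_succ (i + 1), poissonPow_succ i (pderiv 0 f) g, pderiv_comm f 1 0]
    push_cast
    simp only [mul_sub]
    module

/-- For a fixed right argument, only finitely many powers of the bidifferential operator survive. -/
lemma exists_poissonPow_eq_zero : ∃ N, ∀ i ≥ N, ∀ f, poissonPow i f g = 0 := by
  induction g using MvPolynomial.induction_on with
  | C a =>
    refine ⟨1, fun i hi f => ?_⟩
    obtain ⟨i, rfl⟩ := Nat.exists_eq_add_of_le' hi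
    simp [poissonPow_succ]
  | add p q hp hq =>
    obtain ⟨M, hM⟩ := hp
    obtain ⟨N, hN⟩ := hq
    refine ⟨max M N, fun i hi f => ?_⟩
    rw [map_add, hM i (le_of_max_le_left hi), hN i (le_of_max_le_right hi), add_zero]
  | mul_X p n hp =>
    obtain ⟨N, hN⟩ := hp
    refine ⟨N + 1, fun i hi f => ?_⟩
    obtain ⟨i, rfl⟩ := Nat.exists_eq_add_of_le' (le_of_add_le_right hi)
    rw [mul_comm]
    fin_cases n
    · simp [poissonPow_X_zero_mul, hN i (by omega), hN (i + 1) (by omega)]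
    · simp [poissonPow_X_one_mul, hN i (by omega), hN (i + 1) (by omega)]

lemma sum_choose_eq_poissonPow :
    ∑ k ∈ Finset.range (i + 1),
      ((i.choose k : ℝ) * (-1 : ℝ) ^ k) • (dX^[i - k] (dP^[k] f) * dX^[k] (dP^[i - k] g)) =
    poissonPow i f g := by
  have comm : Function.Commute dX dP := fun f => pderiv_comm f 0 1
  have key := Finset.Nat.sum_antidiagonal_eq_sum_range_succ (fun a b => (i.choose a : ℝ) •
    ((-1 : ℝ) ^ a • (dX^[b] (dP^[a] f) * dX^[a] (dP^[b] g)))) i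
  simp only [smul_smul] at key
  rw [← key]
  clear key
  simp only [mul_smul, Nat.cast_smul_eq_nsmul]
  induction i generalizing f g with
  | zero => simp [poissonPow_zero]
  | succ i ih =>
    rw [Finset.sum_antidiagonal_choose_succ_nsmul (fun a b =>
      (-1 : ℝ) ^ a • (dX^[b] (dP^[a] f) * dX^[a] (dP^[b] g))), poissonPow_succ, ← ih, ← ih,
      sub_eq_add_neg, ← Finset.sum_neg_distrib]
    congr 1 <;> refine Finset.sum_congr rfl fun ab hab => ?_
    · rw [Function.iterate_succ_apply, Function.iterate_succ_apply,
        (comm.iterate_right _ : Function.Commute dX _) _]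
      rfl
    · rw [Nat.choose_symm_of_eq_add (Finset.HasAntidiagonal.mem_antidiagonal.1 hab).symm,
        Function.iterate_succ_apply, Function.iterate_succ_apply,
        (comm.iterate_right _ : Function.Commute dX _) _, pow_succ, mul_neg_one, neg_smul, smul_neg]
      rfl

lemma moyal_eq_finsum :
    moyal l f g = ∑ᶠ i : ℕ, (l ^ i / (i.factorial : ℝ)) • poissonPow i f g := by
  simp only [moyal, sum_choose_eq_poissonPow]

lemma exists_moyal_eq_sum : ∃ N, ∀ n ≥ N, ∀ f,
    moyal l f g = ∑ i ∈ Finset.range n, (l ^ i / (i.factorial : ℝ)) • poissonPow i f g := by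
  obtain ⟨N, hN⟩ := exists_poissonPow_eq_zero g
  refine ⟨N, fun n hn f => ?_⟩
  rw [moyal_eq_finsum]
  refine finsum_eq_sum_of_support_subset _ fun i hi => ?_
  by_contra hin
  exact hi (by simp [hN i (by simp at hin; omega) f])

lemma moyal_add_left : moyal l (f + g) h = moyal l f h + moyal l g h := by
  obtain ⟨N, hN⟩ := exists_moyal_eq_sum l h
  simp only [hN N le_rfl, map_add, LinearMap.add_apply, smul_add, Finset.sum_add_distrib]

lemma moyal_add_right : moyal l f (g + h) = moyal l f g + moyal l f h := by
  obtain ⟨M, hM⟩ := exists_moyal_eq_sum l g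
  obtain ⟨N, hN⟩ := exists_moyal_eq_sum l h
  obtain ⟨K, hK⟩ := exists_moyal_eq_sum l (g + h)
  rw [hM (M + N + K) (by omega), hN (M + N + K) (by omega), hK (M + N + K) (by omega)]
  simp only [map_add, smul_add, Finset.sum_add_distrib]

lemma moyal_smul_left (c : ℝ) : moyal l (c • f) g = c • moyal l f g := by
  simp only [moyal_eq_finsum, map_smul, LinearMap.smul_apply, smul_comm _ c, smul_finsum]

lemma moyal_smul_right (c : ℝ) : moyal l f (c • g) = c • moyal l f g := by
  simp only [moyal_eq_finsum, map_smul, smul_comm _ c, smul_finsum]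

lemma moyal_sub_right : moyal l f (g - h) = moyal l f g - moyal l f h := by
  rw [eq_sub_iff_add_eq, ← moyal_add_right, sub_add_cancel]

lemma one_moyal : moyal l 1 f = f := by
  rw [moyal_eq_finsum, finsum_eq_single _ 0]
  · simp [poissonPow_zero]
  · rintro (_ | i) hi
    · exact absurd rfl hi
    · simp [poissonPow_succ]

lemma moyal_one : moyal l f 1 = f := by
  rw [moyal_eq_finsum, finsum_eq_single _ 0]
  · simp [poissonPow_zero]
  · rintro (_ | i) hi
    · exact absurd rfl hi
    · simp [poissonPow_succ]

lemma pderiv_moyal (a : Fin 2) :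
    pderiv a (moyal l f g) = moyal l (pderiv a f) g + moyal l f (pderiv a g) := by
  obtain ⟨M, hM⟩ := exists_moyal_eq_sum l g
  obtain ⟨N, hN⟩ := exists_moyal_eq_sum l (pderiv a g)
  simp only [hM (M + N) (by omega), hN (M + N) (by omega), map_sum, Derivation.map_smul,
    pderiv_poissonPow, smul_add, Finset.sum_add_distrib]

lemma pow_succ_div_factorial_mul :
    l ^ (i + 1) / ((i + 1).factorial : ℝ) * (i + 1) = l * (l ^ i / (i.factorial : ℝ)) := by
  rw [Nat.factorial_succ, pow_succ']
  push_cast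
  field_simp

lemma moyal_X_zero_mul :
    moyal l f (X 0 * g) = X 0 * moyal l f g - l • moyal l (pderiv 1 f) g := by
  obtain ⟨M, hM⟩ := exists_moyal_eq_sum l g
  obtain ⟨N, hN⟩ := exists_moyal_eq_sum l (X 0 * g)
  rw [hM (M + N + 1) (by omega), hN (M + N + 1) (by omega), hM (M + N) (by omega)]
  simp only [Finset.sum_range_succ' _ (M + N), poissonPow_X_zero_mul, smul_sub, smul_smul,
    pow_succ_div_factorial_mul, Finset.sum_sub_distrib, Finset.smul_sum, poissonPow_zero,
    mul_left_comm f]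
  simp only [mul_add, Finset.mul_sum, mul_smul_comm]
  abel

lemma moyal_X_one_mul :
    moyal l f (X 1 * g) = X 1 * moyal l f g + l • moyal l (pderiv 0 f) g := by
  obtain ⟨M, hM⟩ := exists_moyal_eq_sum l g
  obtain ⟨N, hN⟩ := exists_moyal_eq_sum l (X 1 * g)
  rw [hM (M + N + 1) (by omega), hN (M + N + 1) (by omega), hM (M + N) (by omega)]
  simp only [Finset.sum_range_succ' _ (M + N), poissonPow_X_one_mul, smul_add, smul_smul,
    pow_succ_div_factorial_mul, Finset.sum_add_distrib, Finset.smul_sum, poissonPow_zero,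
    mul_left_comm f]
  simp only [mul_add, Finset.mul_sum, mul_smul_comm]
  abel

lemma moyal_X_zero : moyal l f (X 0) = X 0 * f - l • pderiv 1 f := by
  simpa only [mul_one, moyal_one] using moyal_X_zero_mul l f 1

lemma moyal_X_one : moyal l f (X 1) = X 1 * f + l • pderiv 0 f := by
  simpa only [mul_one, moyal_one] using moyal_X_one_mul l f 1

lemma moyal_assoc_X (n : Fin 2) :
    moyal l (moyal l f g) (X n) = moyal l f (moyal l g (X n)) := by
  fin_cases n
  · simp only [Fin.zero_eta, moyal_X_zero, moyal_sub_right, moyal_smul_right, moyal_X_zero_mul,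
      pderiv_moyal, smul_add]
    abel
  · simp only [Fin.mk_one, moyal_X_one, moyal_add_right, moyal_smul_right, moyal_X_one_mul,
      pderiv_moyal, smul_add]
    abel

/-- The right nucleus of the Moyal product: the third arguments that associate with everything. -/
def moyalNucleus : Submodule ℝ (MvPolynomial (Fin 2) ℝ) where
  carrier := {h | ∀ f g, moyal l (moyal l f g) h = moyal l f (moyal l g h)}
  add_mem' hp hq f g := by simp only [moyal_add_right, hp f g, hq f g]
  zero_mem' f g := by
    have h0 : ∀ f, moyal l f 0 = 0 := fun f => by simpa using moyal_smul_right l f 0 0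
    simp only [h0]
  smul_mem' c p hp f g := by simp only [moyal_smul_right, hp f g]

variable {l h}

lemma mem_moyalNucleus :
    h ∈ moyalNucleus l ↔ ∀ f g, moyal l (moyal l f g) h = moyal l f (moyal l g h) := Iff.rfl

lemma pderiv_mem_moyalNucleus (hh : h ∈ moyalNucleus l) (a : Fin 2) :
    pderiv a h ∈ moyalNucleus l := by
  intro f g
  have key := congrArg (pderiv a) (hh f g)
  simp only [pderiv_moyal, moyal_add_left, moyal_add_right] at key
  simp only [mem_moyalNucleus.1 hh] at key
  linear_combination key

lemma moyal_X_mem_moyalNucleus (hh : h ∈ moyalNucleus l) (n : Fin 2) :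
    moyal l h (X n) ∈ moyalNucleus l := by
  intro f g
  rw [← moyal_assoc_X, hh f g, moyal_assoc_X, moyal_assoc_X]

variable (l h)

lemma moyalNucleus_eq_top : moyalNucleus l = ⊤ := by
  refine Submodule.eq_top_iff'.2 fun h => ?_
  induction h using MvPolynomial.induction_on with
  | C a =>
    rw [C_eq_smul_one]
    refine Submodule.smul_mem _ _ fun f g => ?_
    simp only [moyal_one]
  | add p q hp hq => exact Submodule.add_mem _ hp hq
  | mul_X p n hp =>
    rw [mul_comm]
    have hX := moyal_X_mem_moyalNucleus hp n
    fin_cases n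
    · have := Submodule.add_mem _ hX (Submodule.smul_mem _ l (pderiv_mem_moyalNucleus hp 1))
      simpa [moyal_X_zero] using this
    · have := Submodule.sub_mem _ hX (Submodule.smul_mem _ l (pderiv_mem_moyalNucleus hp 0))
      simpa [moyal_X_one] using this

lemma moyal_assoc : moyal l (moyal l f g) h = moyal l f (moyal l g h) :=
  mem_moyalNucleus.1 (moyalNucleus_eq_top l ▸ Submodule.mem_top) f g

end

/-- the Moyal product is associative, and together with the ℝ-bilinearity
and the unit `1` it makes ℝ[x,p] into an associative unital ℝ-algebra. -/
theorem moyal_assoc_and_unital_algebra (l : ℝ) :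
    (∀ f g h : MvPolynomial (Fin 2) ℝ, moyal l (moyal l f g) h = moyal l f (moyal l g h)) ∧
    (∀ f : MvPolynomial (Fin 2) ℝ, moyal l 1 f = f ∧ moyal l f 1 = f) ∧
    (∀ f g h : MvPolynomial (Fin 2) ℝ, moyal l (f + g) h = moyal l f h + moyal l g h) ∧
    (∀ f g h : MvPolynomial (Fin 2) ℝ, moyal l f (g + h) = moyal l f g + moyal l f h) ∧
    (∀ (c : ℝ) (f g : MvPolynomial (Fin 2) ℝ),
      moyal l (c • f) g = c • moyal l f g ∧ moyal l f (c • g) = c • moyal l f g) := by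
  exact ⟨moyal_assoc l, fun f => ⟨one_moyal l f, moyal_one l f⟩, moyal_add_left l,
    moyal_add_right l, fun c f g => ⟨moyal_smul_left l f g c, moyal_smul_right l f g c⟩⟩
end

section
/- (Degree bound, from the proof of Theorem 3.5.) Suppose h₀,…,h_{n−1} ∈ ℝ[p] satisfy the system Σ_{i=0}^{l} C(n, l−i) (2λ)^{n−l+i} d^{n−l+i}h_i/dp^{n−l+i} = 0 for all l = 0, 1, …, n−1. Then for each k = 0, 1, …, n−1, the polynomial g_k := Σ_{i=0}^{k} (2λ)^i h_i · (d^i p^k/dp^i) satisfies d^n g_k/dp^n = 0; i.e., g_k is a polynomial in p of degree at most n−1. -/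
open Polynomial in
theorem natDegree_le_of_iterate_derivative_eq_zero {g : ℝ[X]} {n : ℕ} (hn : 1 ≤ n)
    (hg : derivative^[n] g = 0) : g.natDegree ≤ n - 1 := by
  rw [natDegree_le_iff_coeff_eq_zero]
  intro m hm
  have hcoeff := congrArg (coeff · (m - n)) hg
  simp only [coeff_iterate_derivative, coeff_zero] at hcoeff
  rw [show m - n + n = m by omega, nsmul_eq_mul] at hcoeff
  refine (mul_eq_zero.mp hcoeff).resolve_left ?_
  exact_mod_cast (Nat.descFactorial_pos.mpr (by omega : n ≤ m)).ne'

open Polynomial in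
/-- The Leibniz expansion, regrouped according to the total order of the derivative falling on
`X ^ k`. -/
theorem iterate_derivative_sum_mul_iterate_derivative_X_pow (c : ℝ) (h : ℕ → ℝ[X]) {n k : ℕ}
    (hk : k < n) :
    derivative^[n] (∑ i ∈ Finset.range (k + 1),
        c ^ i • (h i * derivative^[i] ((X : ℝ[X]) ^ k))) =
      ∑ l ∈ Finset.range (k + 1), (∑ i ∈ Finset.range (l + 1),
        ((n.choose (l - i) : ℝ) * c ^ i) • derivative^[n - l + i] (h i)) *
          derivative^[l] ((X : ℝ[X]) ^ k) := by
  have regroup := Finset.sum_range_diag_flip (k + 1) fun i j =>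
    ((n.choose j : ℝ) * c ^ i) •
      (derivative^[n - j] (h i) * derivative^[i + j] ((X : ℝ[X]) ^ k))
  trans ∑ i ∈ Finset.range (k + 1), ∑ j ∈ Finset.range (k + 1 - i),
    ((n.choose j : ℝ) * c ^ i) •
      (derivative^[n - j] (h i) * derivative^[i + j] ((X : ℝ[X]) ^ k))
  · rw [iterate_derivative_sum]
    refine Finset.sum_congr rfl fun i _ => ?_
    rw [iterate_derivative_smul, iterate_derivative_mul, Finset.smul_sum]
    symm
    refine (Finset.sum_subset (Finset.range_mono (by omega)) fun j _ hj => ?_).trans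
      (Finset.sum_congr rfl fun j _ => ?_)
    · rw [Finset.mem_range] at hj
      rw [iterate_derivative_eq_zero (p := (X : ℝ[X]) ^ k) (by rw [natDegree_X_pow]; omega),
        mul_zero, smul_zero]
    · rw [← Function.iterate_add_apply, add_comm j i, ← Nat.cast_smul_eq_nsmul ℝ, smul_smul,
        mul_comm]
  · rw [← regroup]
    refine Finset.sum_congr rfl fun l hl => ?_
    rw [Finset.sum_mul]
    refine Finset.sum_congr rfl fun i hi => ?_
    rw [Finset.mem_range] at hl hi
    rw [smul_mul_assoc, show n - (l - i) = n - l + i by omega, show i + (l - i) = l by omega]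


/-- degree bound: if h₀,…,h_{n−1} ∈ ℝ[p] satisfy
Σ_{i=0}^{l} C(n, l−i) (2λ)^{n−l+i} d^{n−l+i}h_i/dp^{n−l+i} = 0 for all l = 0,…,n−1, then for
each k = 0,…,n−1 the polynomial g_k = Σ_{i=0}^{k} (2λ)^i h_i · (d^i p^k/dp^i) satisfies
d^n g_k/dp^n = 0, i.e. g_k has degree at most n−1. -/
theorem degree_bound (lam : ℝ) (hlam : lam ≠ 0) (n : ℕ) (hn : 1 ≤ n)
    (h : ℕ → Polynomial ℝ)
    (hode : ∀ l ∈ Finset.range n,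
      ∑ i ∈ Finset.range (l + 1),
        ((n.choose (l - i) : ℝ) * (2 * lam) ^ (n - l + i)) •
          (⇑Polynomial.derivative)^[n - l + i] (h i) = 0) :
    ∀ k ∈ Finset.range n,
      (⇑Polynomial.derivative)^[n]
        (∑ i ∈ Finset.range (k + 1),
          (2 * lam) ^ i • (h i * (⇑Polynomial.derivative)^[i] ((Polynomial.X : Polynomial ℝ) ^ k))) = 0 ∧
      (∑ i ∈ Finset.range (k + 1),
        (2 * lam) ^ i • (h i * (⇑Polynomial.derivative)^[i] ((Polynomial.X : Polynomial ℝ) ^ k))).natDegree ≤ n - 1 := by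
  intro k hk
  rw [Finset.mem_range] at hk
  refine (fun hg => ⟨hg, natDegree_le_of_iterate_derivative_eq_zero hn hg⟩) ?_
  rw [iterate_derivative_sum_mul_iterate_derivative_X_pow _ _ hk]
  refine Finset.sum_eq_zero fun l hl => ?_
  have hc : (2 * lam) ^ (n - l) ≠ 0 := pow_ne_zero _ (mul_ne_zero two_ne_zero hlam)
  have hl' : l ∈ Finset.range n := by
    rw [Finset.mem_range] at hl ⊢
    omega
  refine mul_eq_zero_of_left ((smul_eq_zero_iff_right hc).mp ?_) _
  rw [← hode l hl', Finset.smul_sum]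
  refine Finset.sum_congr rfl fun i _ => ?_
  rw [smul_smul, pow_add, mul_left_comm]
end
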